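/- Let A be a unital C*-algebra of real rank zero, let B be a complex unital Banach algebra, and let T : A → B be a surjective additive map with σ(Tx) = σ(x) for all x ∈ A. Then there exists a unital Jordan homomorphism S : A → B (that is, a complex-linear map with S(1) = 1 and S(x²) = (Sx)² for all x ∈ A) such that Sa = Ta for every self-adjoint a ∈ A. -/

import Mathlib

open Filter Topology

/-- An element is quasinilpotent if its spectrum contains no nonzero complex number. -/
def IsQuasinilpotent {B : Type*} [Ring B] [Algebra ℂ B] (n : B) : Prop :=
  ∀ s : ℂ, IsUnit (1 - s • n)

lemma IsQuasinilpotent.smul {R : Type*} [Ring R] [Algebra ℂ R] {n : R} (h : IsQuasinilpotent n)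
    (c : ℂ) : IsQuasinilpotent (c • n) := fun s => by
  rw [smul_smul]
  exact h _

section BanachAlgebra

variable {B : Type*} [NormedRing B] [NormedAlgebra ℂ B] [CompleteSpace B]

lemma isQuasinilpotent_of_pow_le {n : B} (h : ∀ ε > (0 : ℝ), ∃ k ≠ 0, ‖n ^ k‖ ≤ ε ^ k) :
    IsQuasinilpotent n := by
  intro s
  obtain ⟨k, hk, hle⟩ := h (1 / (‖s‖ + 1)) (by positivity)
  have hlt : ‖(s • n) ^ k‖ < 1 := by
    rw [smul_pow, norm_smul, norm_pow]
    calc ‖s‖ ^ k * ‖n ^ k‖ ≤ ‖s‖ ^ k * (1 / (‖s‖ + 1)) ^ k := by gcongr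
      _ = (‖s‖ / (‖s‖ + 1)) ^ k := by rw [← mul_pow]; ring
      _ < 1 := by
        apply pow_lt_one₀ (by positivity) _ hk
        rw [div_lt_one (by positivity)]
        linarith
  have hu := isUnit_one_sub_of_norm_lt_one hlt
  rw [← mul_neg_geom_sum] at hu
  refine ((Commute.isUnit_mul_iff ?_).1 hu).1
  refine Commute.sum_right _ _ _ fun i _ => ?_
  exact ((Commute.one_left _).sub_left (Commute.refl _)).pow_right i

lemma IsQuasinilpotent.eventually_pow_le {n : B} (h : IsQuasinilpotent n) {ε : ℝ} (hε : 0 < ε) :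
    ∀ᶠ k in atTop, ‖n ^ k‖ ≤ ε ^ k := by
  have h0 : spectralRadius ℂ n = 0 := by
    rw [spectralRadius]
    simp only [ENNReal.iSup_eq_zero]
    intro z hz
    by_contra hne
    have hz0 : z ≠ 0 := by rintro rfl; simp at hne
    apply hz
    rw [spectrum.mem_resolventSet_iff]
    have := (h z⁻¹)
    have h2 : algebraMap ℂ B z - n = algebraMap ℂ B z * (1 - z⁻¹ • n) := by
      rw [mul_sub, mul_one, Algebra.algebraMap_eq_smul_one, smul_mul_smul_comm, one_mul,
        mul_inv_cancel₀ hz0, one_smul]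
    rw [h2]
    exact ((IsUnit.mk0 z hz0).map (algebraMap ℂ B)).mul this
  have ht := spectrum.pow_norm_pow_one_div_tendsto_nhds_spectralRadius n
  rw [h0] at ht
  have := ht.eventually (gt_mem_nhds (ENNReal.ofReal_pos.2 hε))
  filter_upwards [this, eventually_ne_atTop 0] with k hk hk0
  rw [ENNReal.ofReal_lt_ofReal_iff hε] at hk
  calc ‖n ^ k‖ = (‖n ^ k‖ ^ (1 / k : ℝ)) ^ k := by
        rw [← Real.rpow_natCast, ← Real.rpow_mul (norm_nonneg _), one_div_mul_cancel, Real.rpow_one]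
        exact_mod_cast hk0
    _ ≤ ε ^ k := by gcongr

lemma IsQuasinilpotent.mul_of_commute {n h : B} (hn : IsQuasinilpotent n) (hc : Commute n h) :
    IsQuasinilpotent (n * h) := by
  refine isQuasinilpotent_of_pow_le fun ε hε => ?_
  have hδ : 0 < ε / (‖h‖ + 1) := by positivity
  obtain ⟨k, hk, hk1⟩ := ((hn.eventually_pow_le hδ).and (eventually_ge_atTop 1)).exists
  refine ⟨k, by omega, ?_⟩
  rw [hc.mul_pow]
  calc ‖n ^ k * h ^ k‖ ≤ ‖n ^ k‖ * ‖h ^ k‖ := norm_mul_le _ _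
    _ ≤ (ε / (‖h‖ + 1)) ^ k * (‖h‖ + 1) ^ k := by
        gcongr
        calc ‖h ^ k‖ ≤ ‖h‖ ^ k := norm_pow_le' _ (by omega)
          _ ≤ _ := by gcongr; linarith
    _ = ε ^ k := by rw [← mul_pow]; congr 1; field_simp

/-- If the pencil `y + w • x` is quasinilpotent for all `w` on a circle about `0`, then `y` is
quasinilpotent. -/
lemma isQuasinilpotent_of_pencil {x y : B} {R : ℝ} (hR : 0 < R)
    (h : ∀ w : ℂ, ‖w‖ = R → IsQuasinilpotent (y + w • x)) : IsQuasinilpotent y := by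
  refine isQuasinilpotent_of_pow_le fun ε hε => ?_
  have hex : ∀ w ∈ Metric.sphere (0 : ℂ) R, ∃ k ≠ 0, ‖(y + w • x) ^ k‖ < ε ^ k := by
    intro w hw
    obtain ⟨k, hk, hk1⟩ := (((h w (by simpa using hw)).eventually_pow_le
      (half_pos hε)).and (eventually_ge_atTop 1)).exists
    refine ⟨k, by omega, hk.trans_lt ?_⟩
    gcongr
    linarith
  choose! k hk0 hk using hex
  obtain ⟨t, ht, hcov⟩ := (isCompact_sphere (0 : ℂ) R).elim_nhds_subcover
    (fun w => {w' | ‖(y + w' • x) ^ k w‖ < ε ^ k w}) (fun w hw => by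
      refine (isOpen_lt ?_ continuous_const).mem_nhds (hk w hw)
      fun_prop)
  set K := ∏ w ∈ t, k w with hK
  have hK0 : K ≠ 0 := Finset.prod_ne_zero_iff.2 fun w hw => hk0 w (ht w hw)
  refine ⟨K, hK0, ?_⟩
  have hbound : ∀ w ∈ Metric.sphere (0 : ℂ) R, ‖(y + w • x) ^ K‖ ≤ ε ^ K := by
    intro w hw
    obtain ⟨w', hw't, hw'⟩ := Set.mem_iUnion₂.1 (hcov hw)
    obtain ⟨m, hm⟩ : k w' ∣ K := Finset.dvd_prod_of_mem k hw't
    have hm0 : 0 < m := Nat.pos_of_ne_zero fun h0 => hK0 (by simp [hm, h0])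
    rw [hm, pow_mul, pow_mul]
    calc ‖((y + w • x) ^ k w') ^ m‖ ≤ ‖(y + w • x) ^ k w'‖ ^ m := norm_pow_le' _ hm0
      _ ≤ _ := by gcongr; exact le_of_lt hw'
  have := Complex.norm_le_of_forall_mem_frontier_norm_le (f := fun w : ℂ => (y + w • x) ^ K)
    (U := Metric.ball 0 R) (C := ε ^ K) Metric.isBounded_ball
    (Differentiable.diffContOnCl (by fun_prop)) (fun w hw => hbound w (by
      rwa [frontier_ball _ hR.ne'] at hw)) (z := 0) (subset_closure (by simpa using hR))
  simpa using this

/-- A quasinilpotent `n` can be written as `w - w ^ 2` with `w` a quasinilpotent commuting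
with the commutant of `n`. -/
lemma IsQuasinilpotent.exists_sub_sq_eq {n : B} (hn : IsQuasinilpotent n) :
    ∃ w : B, IsQuasinilpotent w ∧ w - w * w = n ∧ ∀ x, Commute x n → Commute x w := by
  set f : ℕ → B := fun k => (catalan k : ℂ) • n ^ k with hf
  have hs : Summable fun k => ‖f k‖ := by
    refine summable_of_isBigO_nat (g := fun k => (1 / 2 : ℝ) ^ k)
      (summable_geometric_of_lt_one (by norm_num) (by norm_num)) ?_
    refine Asymptotics.IsBigO.of_bound 1 ?_
    filter_upwards [hn.eventually_pow_le (ε := 1 / 8) (by norm_num)] with k hk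
    have hc : (catalan k : ℝ) ≤ 4 ^ k := by
      have : catalan k ≤ 4 ^ k := by
        rw [catalan_eq_centralBinom_div]
        exact (Nat.div_le_self _ _).trans (Nat.centralBinom_le_four_pow k)
      exact_mod_cast this
    rw [norm_norm, norm_smul, Complex.norm_natCast, one_mul,
      Real.norm_of_nonneg (by positivity)]
    calc (catalan k : ℝ) * ‖n ^ k‖ ≤ 4 ^ k * (1 / 8) ^ k := by gcongr
      _ = (1 / 2) ^ k := by rw [← mul_pow]; norm_num
  have hs' : Summable f := hs.of_norm
  set C : B := ∑' k, f k with hC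
  have hcomm : ∀ x, Commute x n → Commute x C := fun x hx =>
    Commute.tsum_right x fun k => (hx.pow_right k).smul_right _
  have hCn : Commute n C := hcomm n (Commute.refl n)
  have hprod : ∀ k, ∑ ij ∈ Finset.HasAntidiagonal.antidiagonal k, f ij.1 * f ij.2 =
      (catalan (k + 1) : ℂ) • n ^ k := by
    intro k
    rw [catalan_succ', Nat.cast_sum, Finset.sum_smul]
    refine Finset.sum_congr rfl fun ij hij => ?_
    have hij' : ij.1 + ij.2 = k := by simpa using hij
    simp only [hf]
    rw [smul_mul_smul_comm, ← pow_add, hij', Nat.cast_mul]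
  have hsq : C * C = ∑' k, (catalan (k + 1) : ℂ) • n ^ k := by
    rw [hC, tsum_mul_tsum_eq_tsum_sum_antidiagonal_of_summable_norm hs hs]
    simp only [hprod]
  have hrec : C = 1 + n * (C * C) := by
    have hs1 : Summable fun k => (catalan (k + 1) : ℂ) • n ^ k := by
      have := (summable_norm_sum_mul_antidiagonal_of_summable_norm hs hs).of_norm
      simpa only [hprod] using this
    rw [hsq, ← hs1.tsum_mul_left, hC, hs'.tsum_eq_zero_add]
    simp [hf, pow_succ']
  refine ⟨n * C, hn.mul_of_commute hCn, ?_, fun x hx => hx.mul_right (hcomm x hx)⟩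
  have : n * C * (n * C) = n * (n * (C * C)) := by
    rw [mul_assoc n C, ← mul_assoc C n C, ← hCn.eq, mul_assoc n C C]
  rw [this, ← mul_sub, sub_eq_of_eq_add hrec, mul_one]

lemma isUnit_one_sub_mul_swap {R : Type*} [Ring R] {a b : R} (h : IsUnit (1 - a * b)) :
    IsUnit (1 - b * a) := by
  obtain ⟨u, hu⟩ := h
  have h1 : (1 - a * b) * (↑u⁻¹ : R) = 1 := by rw [← hu]; simp
  have h2 : (↑u⁻¹ : R) * (1 - a * b) = 1 := by rw [← hu]; simp
  generalize (↑u⁻¹ : R) = c at h1 h2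
  refine isUnit_iff_exists.2 ⟨1 + b * c * a, ?_, ?_⟩
  · calc (1 - b * a) * (1 + b * c * a) = 1 - b * a + b * ((1 - a * b) * c) * a := by noncomm_ring
      _ = 1 := by rw [h1]; noncomm_ring
  · calc (1 + b * c * a) * (1 - b * a) = 1 - b * a + b * (c * (1 - a * b)) * a := by noncomm_ring
      _ = 1 := by rw [h2]; noncomm_ring

/-- If `0` stays isolated in the spectrum of `v * q` for `v` near `1`, uniformly, and the corner
`(1 - e) * q` is quasinilpotent, then that corner lies in the Jacobson radical. -/
lemma isUnit_one_sub_mul_corner {q e : B} (he : e * e = e) (hqe : q * e = e * q)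
    (hn : IsQuasinilpotent ((1 - e) * q))
    (H : ∀ᶠ v in 𝓝 (1 : B), ∀ s : ℂ, 2 ≤ ‖s‖ → IsUnit (1 - s • (v * q))) (y : B) :
    IsUnit (1 - y * ((1 - e) * q)) := by
  set f := 1 - e with hf
  have hff : f * f = f := IsIdempotentElem.one_sub he
  have hef : e * f = 0 := by rw [hf, mul_sub, he]; simp
  have hfe : f * e = 0 := by rw [hf, sub_mul, he]; simp
  have hqf : q * f = f * q := by rw [hf, mul_sub, sub_mul, hqe]; simp
  set n := f * q with hndef
  have hnf : n * f = n := by rw [hndef, mul_assoc, hqf, ← mul_assoc, hff]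
  have hfn : f * n = n := by rw [hndef, ← mul_assoc, hff]
  have hne : n * e = 0 := by rw [← hnf, mul_assoc, hfe, mul_zero]
  have hqn : q = n + e * q := by rw [hndef, hf]; noncomm_ring
  set y₁ := f * y * f with hy₁
  have hyn : y₁ * q = y₁ * n := by
    rw [hy₁, hndef, mul_assoc _ f (f * q), ← mul_assoc f f q, hff, ← mul_assoc]
  have hprod : ∀ (s z : ℂ), (1 - s • (n + z • (y₁ * n))) * (1 - s • (e * q)) =
      1 - s • ((1 + z • y₁) * q) := by
    intro s z
    have h0 : (n + z • (y₁ * n)) * (e * q) = 0 := by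
      rw [add_mul, smul_mul_assoc, mul_assoc y₁, ← mul_assoc n, hne]; simp
    calc _ = 1 - s • (n + z • (y₁ * n)) - s • (e * q)
          + (s * s) • ((n + z • (y₁ * n)) * (e * q)) := by
          rw [sub_mul, one_mul, mul_sub, mul_one, smul_mul_smul_comm]; abel
      _ = 1 - s • ((n + e * q) + z • (y₁ * n)) := by
          rw [h0]; simp only [smul_add, smul_zero]; abel
      _ = _ := by rw [← hqn, ← hyn, add_mul, one_mul, smul_mul_assoc]
  have hcont : Tendsto (fun z : ℂ => 1 + z • y₁) (𝓝 0) (𝓝 1) := by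
    have : Continuous fun z : ℂ => 1 + z • y₁ := by fun_prop
    simpa using this.tendsto 0
  have hlarge : ∀ᶠ z : ℂ in 𝓝 0, ∀ s : ℂ, 2 ≤ ‖s‖ → IsUnit (1 - s • (n + z • (y₁ * n))) := by
    filter_upwards [hcont.eventually H] with z hz s hs
    have h1 : IsUnit (1 - s • (e * q)) := by
      have h2 := hprod s 0
      simp only [zero_smul, add_zero, one_mul] at h2
      have h3 := H.self_of_nhds s hs
      rw [one_mul, ← h2] at h3
      obtain ⟨u, hu⟩ := hn s
      rw [← hu] at h3
      exact (Units.isUnit_units_mul u _).1 h3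
    have h2 := hz s hs
    rw [← hprod] at h2
    obtain ⟨u, hu⟩ := h1
    rw [← hu] at h2
    exact (Units.isUnit_mul_units _ u).1 h2
  have hsmall : ∀ᶠ z : ℂ in 𝓝 0, ∀ s ∈ Metric.closedBall (0 : ℂ) 2,
      IsUnit (1 - s • (n + z • (y₁ * n))) := by
    refine (isCompact_closedBall (0 : ℂ) 2).eventually_forall_of_forall_eventually fun s _ => ?_
    have hc : Continuous fun p : ℂ × ℂ => 1 - p.2 • (n + p.1 • (y₁ * n)) := by fun_prop
    refine hc.continuousAt.eventually (Units.isOpen.mem_nhds ?_)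
    simpa using hn s
  have hall : ∀ᶠ z : ℂ in 𝓝 0, IsQuasinilpotent (n + z • (y₁ * n)) := by
    filter_upwards [hlarge, hsmall] with z h1 h2 s
    rcases le_total 2 ‖s‖ with h | h
    · exact h1 s h
    · exact h2 s (by simpa using h)
  obtain ⟨δ, hδ, hball⟩ := Metric.eventually_nhds_iff.1 hall
  have hq : IsQuasinilpotent (y₁ * n) := by
    refine isQuasinilpotent_of_pencil (x := n) (R := 2 / δ) (by positivity) fun w hw => ?_
    have hw0 : w ≠ 0 := by
      rintro rfl
      rw [norm_zero] at hw
      exact absurd hw (by positivity)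
    have := (hball (y := w⁻¹) (by
      rw [dist_zero_right, norm_inv, hw, inv_div]; exact half_lt_self hδ)).smul w
    rwa [smul_add, smul_smul, mul_inv_cancel₀ hw0, one_smul, add_comm] at this
  have h1 := hq 1
  rw [one_smul] at h1
  have e1 : y₁ * n = f * (y * n) := by rw [hy₁, mul_assoc, hfn, mul_assoc]
  rw [e1] at h1
  have h2 := isUnit_one_sub_mul_swap h1
  rwa [mul_assoc, hnf] at h2

/-- In a Banach algebra with trivial Jacobson radical, an element whose spectrum stays close to
`{0, 1}` under perturbations is idempotent. -/
lemma mul_self_eq_of_perturbation {q : B} (hrad : ∀ n : B, (∀ y, IsUnit (1 - y * n)) → n = 0)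
    (hq : IsQuasinilpotent (q - q * q))
    (H : ∀ᶠ v in 𝓝 (1 : B), ∀ s : ℂ, 2 ≤ ‖s‖ → IsUnit (1 - s • (v * q)))
    (H' : ∀ᶠ v in 𝓝 (1 : B), ∀ s : ℂ, 2 ≤ ‖s‖ → IsUnit (1 - s • (v * (1 - q)))) :
    q * q = q := by
  obtain ⟨w, hw, hwn, hcomm⟩ := hq.exists_sub_sq_eq
  have hqw : Commute q w := hcomm q ((Commute.refl q).sub_right ((Commute.refl q).mul_right
    (Commute.refl q)))
  obtain ⟨u, hu⟩ := hw 2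
  have h2w : (↑u : B) = 1 - 2 * w := by rw [hu, two_smul, two_mul]
  have hqu : Commute q ↑u⁻¹ := by
    apply Commute.units_inv_right
    rw [h2w]
    exact (Commute.one_right q).sub_right ((Commute.ofNat_right q 2).mul_right hqw)
  have hwu : Commute w ↑u⁻¹ := by
    apply Commute.units_inv_right
    rw [h2w]
    exact (Commute.one_right w).sub_right ((Commute.ofNat_right w 2).mul_right (Commute.refl w))
  have huc : (1 - 2 * w) * (↑u⁻¹ : B) = 1 := by rw [← h2w]; simp
  have hcu : (↑u⁻¹ : B) * (1 - 2 * w) = 1 := by rw [← h2w]; simp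
  set c : B := ↑u⁻¹ with hc
  set r : B := (1 - 2 * q) * c with hr
  have hrr : r * r = 1 := by
    have h1 : (1 - 2 * q) * (1 - 2 * q) = (1 - 2 * w) * (1 - 2 * w) := by
      calc (1 - 2 * q) * (1 - 2 * q) = 1 - 4 * (q - q * q) := by noncomm_ring
        _ = 1 - 4 * (w - w * w) := by rw [hwn]
        _ = _ := by noncomm_ring
    have h2 : Commute c (1 - 2 * q) :=
      (Commute.one_right c).sub_right ((Commute.ofNat_right c 2).mul_right hqu.symm)
    have h3 : Commute c (1 - 2 * w) :=
      (Commute.one_right c).sub_right ((Commute.ofNat_right c 2).mul_right hwu.symm)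
    rw [hr, h2.mul_mul_mul_comm, h1, ← h3.mul_mul_mul_comm, huc, one_mul]
  have hrw : r * (1 - 2 * w) = 1 - 2 * q := by
    rw [hr, mul_assoc, hcu, mul_one]
  have hwr : Commute w r :=
    ((Commute.one_right w).sub_right ((Commute.ofNat_right w 2).mul_right hqw.symm)).mul_right hwu
  have hqr : Commute q r :=
    ((Commute.one_right q).sub_right
      ((Commute.ofNat_right q 2).mul_right (Commute.refl q))).mul_right hqu
  set e : B := (1 / 2 : ℂ) • (1 - r) with hedef
  have her : e * r = -e := by rw [hedef, smul_mul_assoc, sub_mul, hrr, one_mul]; module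
  have her' : (1 - e) * r = 1 - e := by rw [sub_mul, her, one_mul, hedef]; module
  have hee : e * e = e := by
    conv_lhs => rw [hedef, mul_smul_comm, mul_sub, ← hedef, her, mul_one]
    module
  have hqe : q = e + r * w := by
    have h1 : r - r * w - r * w = 1 - q - q := by
      rw [mul_sub, mul_one, two_mul, mul_add, two_mul] at hrw
      rw [sub_sub, hrw, sub_sub]
    have h2 : r = 1 - q - q + r * w + r * w := by rw [← h1]; abel
    have h3 : q = (1 / 2 : ℂ) • (1 - (1 - q - q + r * w + r * w)) + r * w := by module
    rw [← h2] at h3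
    exact h3
  have hwe : Commute w e := ((Commute.one_right w).sub_right hwr).smul_right _
  have hqe' : Commute q e := ((Commute.one_right q).sub_right hqr).smul_right _
  have hn₁ : (1 - e) * q = w * (1 - e) := by
    rw [((Commute.one_right w).sub_right hwe).eq]
    conv_lhs => rw [hqe]
    rw [mul_add, ← mul_assoc, her', sub_mul, hee]
    simp
  have hn₂ : e * (1 - q) = w * e := by
    rw [hwe.eq]
    conv_lhs => rw [hqe]
    rw [mul_sub, mul_add, ← mul_assoc, her, hee]
    simp
  have h₁ : (1 - e) * q = 0 := hrad _ fun y =>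
    isUnit_one_sub_mul_corner hee hqe'.eq
      (hn₁ ▸ hw.mul_of_commute ((Commute.one_right w).sub_right hwe)) H y
  have h₂ : e * (1 - q) = 0 := hrad _ fun y => by
    have := isUnit_one_sub_mul_corner (q := 1 - q) (e := 1 - e)
      (IsIdempotentElem.one_sub hee)
      (((Commute.one_right _).sub_right ((Commute.one_left e).sub_left hqe')).eq)
      (by rw [sub_sub_cancel, hn₂]; exact hw.mul_of_commute hwe) H' y
    rwa [sub_sub_cancel] at this
  have hqeq : q = e := by
    rw [sub_mul, one_mul, sub_eq_zero] at h₁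
    rw [mul_sub, mul_one, sub_eq_zero] at h₂
    rw [h₁, ← h₂]
  rw [hqeq, hee]

end BanachAlgebra

section Resolvent

variable {B : Type*} [NormedRing B] [NormedAlgebra ℂ B] [CompleteSpace B]

/-- A part of the spectrum that is encircled by a contour in the resolvent set cannot disappear
under small perturbations. -/
lemma isUnit_sub_algebraMap_of_perturbation {y : B} {x : ℕ → B} (hx : Tendsto x atTop (𝓝 0))
    {c : ℂ} {ρ : ℝ} (hρ : 0 < ρ)
    (hy : ∀ μ ∈ Metric.sphere c ρ, IsUnit (y - algebraMap ℂ B μ))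
    (hyx : ∀ᶠ k in atTop, ∀ μ ∈ Metric.closedBall c ρ, IsUnit (y + x k - algebraMap ℂ B μ)) :
    ∀ μ ∈ Metric.closedBall c ρ, IsUnit (y - algebraMap ℂ B μ) := by
  have hinv : ∀ b : B, IsUnit b → ContinuousAt Ring.inverse b := by
    rintro _ ⟨u, rfl⟩
    exact NormedRing.inverse_continuousAt u
  have hmap : Continuous fun p : B × ℂ => p.1 - algebraMap ℂ B p.2 :=
    continuous_fst.sub ((continuous_algebraMap ℂ B).comp continuous_snd)
  obtain ⟨M, hM⟩ := (isCompact_sphere c ρ).exists_bound_of_continuousOn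
    (f := fun μ => Ring.inverse (y - algebraMap ℂ B μ)) (fun μ hμ => by
      have h1 : ContinuousAt (fun μ : ℂ => y - algebraMap ℂ B μ) μ :=
        (continuous_const.sub (continuous_algebraMap ℂ B)).continuousAt
      exact (ContinuousAt.comp (f := fun μ : ℂ => y - algebraMap ℂ B μ)
        (hinv _ (hy μ hμ)) h1).continuousWithinAt)
  have hM1 : ∀ᶠ b in 𝓝 y, ∀ μ ∈ Metric.sphere c ρ,
      ‖Ring.inverse (b - algebraMap ℂ B μ)‖ < M + 1 := by
    refine (isCompact_sphere c ρ).eventually_forall_of_forall_eventually fun μ hμ => ?_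
    have h2 : ContinuousAt (fun p : B × ℂ => ‖Ring.inverse (p.1 - algebraMap ℂ B p.2)‖) (y, μ) :=
      (ContinuousAt.comp (f := fun p : B × ℂ => p.1 - algebraMap ℂ B p.2) (x := (y, μ))
        (hinv _ (hy μ hμ)) hmap.continuousAt).norm
    exact h2.eventually (gt_mem_nhds ((hM μ hμ).trans_lt (lt_add_one M)))
  have hyxt : Tendsto (fun k => y + x k) atTop (𝓝 y) := by
    simpa using tendsto_const_nhds.add hx
  have hM0 : 0 < M + 1 := by
    have : c + ρ ∈ Metric.sphere c ρ := by simp [abs_of_pos hρ]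
    have := (norm_nonneg _).trans (hM _ this)
    linarith
  have hsmall : ∀ᶠ k in atTop, ‖x k‖ < 1 / (M + 1) := by
    have := hx.norm
    rw [norm_zero] at this
    exact this.eventually (gt_mem_nhds (by positivity))
  obtain ⟨k, hk1, hk2, hk3⟩ := (hyx.and ((hyxt.eventually hM1).and hsmall)).exists
  intro μ hμ
  have hdiff : DifferentiableOn ℂ (fun μ : ℂ => Ring.inverse (y + x k - algebraMap ℂ B μ))
      (Metric.closedBall c ρ) := by
    intro ν hν
    have h1 : DifferentiableAt ℂ Ring.inverse (y + x k - algebraMap ℂ B ν) :=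
      differentiableAt_inverse (hk1 ν hν)
    have h2 : DifferentiableAt ℂ (fun ν : ℂ => y + x k - algebraMap ℂ B ν) ν :=
      (differentiableAt_const _).sub (Algebra.linearMap ℂ B).toContinuousLinearMap.differentiableAt
    exact (DifferentiableAt.comp ν h1 h2).differentiableWithinAt
  have hbd := Complex.norm_le_of_forall_mem_frontier_norm_le (U := Metric.ball c ρ) (C := M + 1)
    Metric.isBounded_ball (f := fun μ : ℂ => Ring.inverse (y + x k - algebraMap ℂ B μ))
    (DifferentiableOn.diffContOnCl (by rwa [closure_ball c hρ.ne']))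
    (fun ν hν => (hk2 ν (by rwa [frontier_ball c hρ.ne'] at hν)).le)
    (z := μ) (by rwa [closure_ball c hρ.ne'])
  obtain ⟨u, hu⟩ := hk1 μ hμ
  simp only [← hu, Ring.inverse_unit] at hbd
  have h3 : y - algebraMap ℂ B μ = u * (1 - (↑u⁻¹ : B) * x k) := by
    rw [mul_sub, mul_one, Units.mul_inv_cancel_left, hu]
    abel
  rw [h3]
  refine u.isUnit.mul (isUnit_one_sub_of_norm_lt_one ?_)
  calc ‖(↑u⁻¹ : B) * x k‖ ≤ ‖(↑u⁻¹ : B)‖ * ‖x k‖ := norm_mul_le _ _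
    _ ≤ (M + 1) * ‖x k‖ := by gcongr
    _ < (M + 1) * (1 / (M + 1)) := by gcongr
    _ = 1 := by field_simp

end Resolvent

section CStar

open Complex ComplexStarModule

variable {A : Type*} [CStarAlgebra A]

lemma nontrivial_of_mem_spectrum {R : Type*} [Ring R] [Algebra ℂ R] {x : R} {w : ℂ}
    (hw : w ∈ spectrum ℂ x) : Nontrivial R := by
  by_contra hn
  rw [not_nontrivial_iff_subsingleton] at hn
  simp [spectrum.of_subsingleton] at hw

lemma IsSelfAdjoint.eq_zero_of_spectrum {u : A} (hu : IsSelfAdjoint u)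
    (h : ∀ z ∈ spectrum ℂ u, z = 0) : u = 0 := by
  have h1 := hu.spectralRadius_eq_nnnorm
  have h2 : spectralRadius ℂ u = 0 := by
    rw [spectralRadius]
    simp only [ENNReal.iSup_eq_zero]
    intro z hz
    simp [h z hz]
  rw [h2] at h1
  simpa using h1.symm

lemma eq_zero_of_spectrum_add_subset {z : A}
    (h : ∀ x : A, IsSelfAdjoint x → spectrum ℂ (x + z) ⊆ spectrum ℂ x) : z = 0 := by
  have hz := realPart_add_I_smul_imaginaryPart z
  have hu := (ℜ z).2
  have hv := (ℑ z).2
  generalize (ℜ z : A) = u at hz hu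
  generalize (ℑ z : A) = v at hz hv
  change IsSelfAdjoint u at hu
  change IsSelfAdjoint v at hv
  have hv0 : v = 0 := hv.eq_zero_of_spectrum fun w hw => by
    have := nontrivial_of_mem_spectrum hw
    have h1 := h (-u) hu.neg
    rw [← hz, neg_add_cancel_left, spectrum.smul_eq_smul _ _ ⟨w, hw⟩] at h1
    have h2 := hu.neg.im_eq_zero_of_mem_spectrum (h1 (Set.smul_mem_smul_set hw))
    have h3 := hv.im_eq_zero_of_mem_spectrum hw
    simp at h2
    exact Complex.ext h2 h3
  rw [← hz, hv0, smul_zero, add_zero]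
  refine hu.eq_zero_of_spectrum fun w hw => ?_
  have h1 := h 0 (IsSelfAdjoint.zero A)
  rw [← hz, hv0, smul_zero, add_zero, zero_add] at h1
  have h2 := h1 hw
  have := nontrivial_of_mem_spectrum hw
  simpa using h2

lemma eq_zero_of_spectrum_subset_add {z : A}
    (h : ∀ x : A, IsSelfAdjoint x → spectrum ℂ x ⊆ spectrum ℂ (x + z)) : z = 0 := by
  have hz := realPart_add_I_smul_imaginaryPart z
  have hu := (ℜ z).2
  have hv := (ℑ z).2
  generalize (ℜ z : A) = u at hz hu
  generalize (ℑ z : A) = v at hz hv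
  change IsSelfAdjoint u at hu
  change IsSelfAdjoint v at hv
  have hne : ∀ (x : A), ∀ w ∈ spectrum ℂ x, (spectrum ℂ v).Nonempty := by
    intro x w hw
    have := nontrivial_of_mem_spectrum hw
    exact spectrum.nonempty v
  have hu0 : u = 0 := by
    rw [← neg_eq_zero]
    refine hu.neg.eq_zero_of_spectrum fun w hw => ?_
    have := nontrivial_of_mem_spectrum hw
    have h1 := h (-u) hu.neg hw
    rw [← hz, neg_add_cancel_left, spectrum.smul_eq_smul _ _ (hne _ w hw)] at h1
    obtain ⟨m, hm, rfl⟩ := h1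
    have h2 := hu.neg.im_eq_zero_of_mem_spectrum hw
    have h3 := hv.im_eq_zero_of_mem_spectrum hm
    simp at h2
    simp [Complex.ext_iff, h2, h3]
  rw [hu0, zero_add] at hz
  rw [← hz]
  suffices v = 0 by rw [this, smul_zero]
  refine hv.eq_zero_of_spectrum fun w hw => ?_
  have := nontrivial_of_mem_spectrum hw
  have h1 := h v hv hw
  rw [← hz, show v + I • v = (1 + I) • v by rw [add_smul, one_smul],
    spectrum.smul_eq_smul _ _ ⟨w, hw⟩] at h1
  obtain ⟨m, hm, rfl⟩ := h1
  have h2 := hv.im_eq_zero_of_mem_spectrum hw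
  have h3 := hv.im_eq_zero_of_mem_spectrum hm
  simp [h3] at h2
  simp [Complex.ext_iff, h2, h3]

lemma IsSelfAdjoint.isUnit_add {a x : A} (ha : IsSelfAdjoint a) {d : ℝ}
    (hd : ∀ z ∈ spectrum ℂ a, d ≤ ‖z‖) (hx : ‖x‖ < d) : IsUnit (a + x) := by
  have hd0 : 0 < d := (norm_nonneg x).trans_lt hx
  have hau : IsUnit a := by
    by_contra hn
    have := hd 0 (by rwa [spectrum.zero_mem_iff])
    rw [norm_zero] at this
    linarith
  obtain ⟨u, rfl⟩ := hau
  have hinv : ‖(↑u⁻¹ : A)‖ ≤ d⁻¹ := by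
    have hsa : IsSelfAdjoint (↑u⁻¹ : A) := by
      rw [← Ring.inverse_unit]
      exact ha.ringInverse
    have h1 : spectralRadius ℂ (↑u⁻¹ : A) ≤ ENNReal.ofReal d⁻¹ := by
      rw [spectralRadius]
      refine iSup₂_le fun z hz => ?_
      have h3 : d ≤ ‖z⁻¹‖ := hd _ (by
        rw [← Set.inv_mem_inv, inv_inv]
        rwa [spectrum.map_inv])
      have h4 : 0 < ‖z‖ := by
        rw [norm_inv] at h3
        exact inv_pos.1 (hd0.trans_le h3)
      rw [← enorm_eq_nnnorm, ← ofReal_norm]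
      refine ENNReal.ofReal_le_ofReal ?_
      rw [norm_inv] at h3
      exact (le_inv_comm₀ hd0 h4).1 h3
    rw [hsa.spectralRadius_eq_nnnorm, ← enorm_eq_nnnorm, ← ofReal_norm] at h1
    exact (ENNReal.ofReal_le_ofReal_iff (by positivity)).1 h1
  have h3 : (u : A) + x = u * (1 - (-((↑u⁻¹ : A) * x))) := by
    rw [sub_neg_eq_add, mul_add, mul_one, Units.mul_inv_cancel_left]
  rw [h3]
  refine u.isUnit.mul (isUnit_one_sub_of_norm_lt_one ?_)
  rw [norm_neg]
  calc ‖(↑u⁻¹ : A) * x‖ ≤ ‖(↑u⁻¹ : A)‖ * ‖x‖ := norm_mul_le _ _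
    _ ≤ d⁻¹ * ‖x‖ := by gcongr
    _ < d⁻¹ * d := by gcongr
    _ = 1 := by field_simp

/-- In a C*-algebra of real rank zero the self-adjoint elements whose spectrum avoids the
rational numbers are dense. -/
lemma exists_isSelfAdjoint_forall_isUnit_sub_rat
    (hrr0 : ∀ a : A, IsSelfAdjoint a → a ∈ closure {x : A | IsSelfAdjoint x ∧ IsUnit x})
    {a : A} (ha : IsSelfAdjoint a) {ε : ℝ} (hε : 0 < ε) :
    ∃ b : A, IsSelfAdjoint b ∧ ‖a - b‖ < ε ∧ ∀ r : ℚ, IsUnit (b - algebraMap ℂ A r) := by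
  have hclosed : IsClosed (selfAdjoint A : Set A) := isClosed_eq continuous_star continuous_id
  have : CompleteSpace (selfAdjoint A) := hclosed.completeSpace_coe
  have hdense : Dense (⋂ r : ℚ, {b : selfAdjoint A | IsUnit ((b : A) - algebraMap ℂ A r)}) := by
    refine dense_iInter_of_isOpen (fun r => ?_) fun r => ?_
    · exact Units.isOpen.preimage (continuous_subtype_val.sub continuous_const)
    · rw [Metric.dense_iff]
      intro b δ hδ
      have hr : IsSelfAdjoint (algebraMap ℂ A r) := by
        refine IsSelfAdjoint.algebraMap A ?_
        simp [IsSelfAdjoint]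
      obtain ⟨x, ⟨hx, hxu⟩, hdist⟩ := Metric.mem_closure_iff.1
        (hrr0 ((b : A) - algebraMap ℂ A r) (b.2.sub hr)) δ hδ
      refine ⟨⟨x + algebraMap ℂ A r, hx.add hr⟩, ?_, ?_⟩
      · rw [Metric.mem_ball, Subtype.dist_eq, dist_comm, dist_eq_norm]
        rw [dist_eq_norm] at hdist
        convert hdist using 2
        simp only
        abel
      · simpa using hxu
  obtain ⟨b, hb, hdist⟩ := Metric.dense_iff.1 hdense ⟨a, ha⟩ ε hε
  refine ⟨b, b.2, ?_, fun r => ?_⟩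
  · rw [Metric.mem_ball, Subtype.dist_eq, dist_comm, dist_eq_norm] at hb
    exact hb
  · exact Set.mem_iInter.1 hdist r

end CStar

section Preserver

variable {A : Type*} [CStarAlgebra A] {B : Type*} [NormedRing B] [NormedAlgebra ℂ B]
  {T : A →+ B}

lemma isUnit_map_sub_algebraMap_iff (hspec : ∀ x, spectrum ℂ (T x) = spectrum ℂ x) {x : A}
    {μ : ℂ} : IsUnit (T x - algebraMap ℂ B μ) ↔ IsUnit (x - algebraMap ℂ A μ) := by
  have h : μ ∈ spectrum ℂ (T x) ↔ μ ∈ spectrum ℂ x := by rw [hspec]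
  rw [spectrum.mem_iff, spectrum.mem_iff, not_iff_not] at h
  rwa [IsUnit.sub_iff, IsUnit.sub_iff (x := x)]

lemma injective_of_spectrum_eq (hspec : ∀ x, spectrum ℂ (T x) = spectrum ℂ x) :
    Function.Injective T := by
  rw [injective_iff_map_eq_zero]
  intro z hz
  refine eq_zero_of_spectrum_add_subset fun x _ => ?_
  rw [← hspec (x + z), map_add, hz, add_zero, hspec]

lemma map_algebraMap_of_spectrum_eq (hsurj : Function.Surjective T)
    (hspec : ∀ x, spectrum ℂ (T x) = spectrum ℂ x) (μ : ℂ) :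
    T (algebraMap ℂ A μ) = algebraMap ℂ B μ := by
  obtain ⟨z, hz⟩ := hsurj (T (algebraMap ℂ A μ) - algebraMap ℂ B μ)
  have hz0 : z = 0 := eq_zero_of_spectrum_add_subset fun x _ ν hν => by
    rw [spectrum.mem_iff, IsUnit.sub_iff, ← isUnit_map_sub_algebraMap_iff hspec, map_add, hz,
      show T x + (T (algebraMap ℂ A μ) - algebraMap ℂ B μ) - algebraMap ℂ B ν =
        T (x + algebraMap ℂ A μ) - algebraMap ℂ B (μ + ν) by rw [map_add, map_add]; abel,
      isUnit_map_sub_algebraMap_iff hspec] at hν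
    rw [spectrum.mem_iff, IsUnit.sub_iff]
    convert hν using 2
    rw [map_add]
    abel
  rwa [hz0, map_zero, eq_comm, sub_eq_zero] at hz

/-- The target of a surjective additive spectrum preserving map is semisimple. -/
lemma eq_zero_of_forall_isUnit_one_sub_mul (hsurj : Function.Surjective T)
    (hspec : ∀ x, spectrum ℂ (T x) = spectrum ℂ x) {n : B}
    (hn : ∀ y, IsUnit (1 - y * n)) : n = 0 := by
  obtain ⟨z, rfl⟩ := hsurj n
  suffices z = 0 by rw [this, map_zero]
  refine eq_zero_of_spectrum_add_subset fun x _ ν => ?_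
  rw [spectrum.mem_iff, spectrum.mem_iff, not_imp_not, IsUnit.sub_iff,
    IsUnit.sub_iff (y := x + z), ← isUnit_map_sub_algebraMap_iff hspec,
    ← isUnit_map_sub_algebraMap_iff hspec, map_add]
  rintro ⟨u, hu⟩
  have h : T x + T z - algebraMap ℂ B ν = u * (1 - (-(↑u⁻¹ : B)) * T z) := by
    rw [neg_mul, sub_neg_eq_add, mul_add, mul_one, Units.mul_inv_cancel_left, hu]
    abel
  rw [h]
  exact u.isUnit.mul (hn _)

/-- The separating space of a surjective additive spectrum preserving map is trivial. -/
lemma eq_zero_of_tendsto_map [CompleteSpace B]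
    (hrr0 : ∀ a : A, IsSelfAdjoint a → a ∈ closure {x : A | IsSelfAdjoint x ∧ IsUnit x})
    (hspec : ∀ x, spectrum ℂ (T x) = spectrum ℂ x) {x : ℕ → A} {z : A}
    (hx : Tendsto x atTop (𝓝 0)) (hTx : Tendsto (fun k => T (x k)) atTop (𝓝 (T z))) :
    z = 0 := by
  refine eq_zero_of_spectrum_subset_add fun y hy l hl => ?_
  rw [spectrum.mem_iff, IsUnit.sub_iff]
  intro hu
  have hlre : l = (l.re : ℂ) := hy.mem_spectrum_eq_re hl
  generalize l.re = t at hlre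
  subst hlre
  have hcont : ContinuousAt (fun p : A × ℂ => p.1 + z - algebraMap ℂ A p.2) (y, (t : ℂ)) :=
    ((continuous_fst.add continuous_const).sub
      ((continuous_algebraMap ℂ A).comp continuous_snd)).continuousAt
  obtain ⟨ε, hε, hball⟩ := Metric.mem_nhds_iff.1
    (hcont.preimage_mem_nhds (Units.isOpen.mem_nhds hu))
  have hball' : ∀ (y' : A) (μ : ℂ), ‖y - y'‖ < ε → ‖μ - t‖ < ε →
      IsUnit (y' + z - algebraMap ℂ A μ) := by
    intro y' μ h1 h2
    refine hball (a := (y', μ)) ?_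
    rw [Metric.mem_ball, Prod.dist_eq, max_lt_iff, dist_comm, dist_eq_norm, dist_eq_norm]
    exact ⟨h1, h2⟩
  obtain ⟨r₁, hr₁, hr₁t⟩ := exists_rat_btwn (show t - ε / 2 < t by linarith)
  obtain ⟨r₂, hr₂t, hr₂⟩ := exists_rat_btwn (show t < t + ε / 2 by linarith)
  set d := min ((t : ℝ) - r₁) (r₂ - t) with hd
  have hd0 : 0 < d := lt_min (by linarith) (by linarith)
  have hd1 : d ≤ t - r₁ := min_le_left _ _
  have hd2 : d ≤ r₂ - t := min_le_right _ _
  obtain ⟨y', hy', hdist, hrat⟩ := exists_isSelfAdjoint_forall_isUnit_sub_rat hrr0 hy hd0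
  set c : ℝ := (r₁ + r₂) / 2 with hc
  set ρ : ℝ := (r₂ - r₁) / 2 with hρ
  have hρ0 : 0 < ρ := by rw [hρ]; linarith
  have hreal : ∀ s : ℝ, |s - c| ≤ ρ → ((s : ℂ)) ∈ Metric.closedBall (c : ℂ) ρ := by
    intro s hs
    rw [Metric.mem_closedBall, dist_eq_norm, ← Complex.ofReal_sub, Complex.norm_real]
    exact hs
  have hsphere : ∀ μ ∈ Metric.sphere (c : ℂ) ρ, IsUnit (y' - algebraMap ℂ A μ) := by
    intro μ hμ
    by_contra hn
    have hmem : μ ∈ spectrum ℂ y' := by rwa [spectrum.mem_iff, IsUnit.sub_iff]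
    have hre : μ = (μ.re : ℂ) := hy'.mem_spectrum_eq_re hmem
    rw [hre, mem_sphere_iff_norm, ← Complex.ofReal_sub, Complex.norm_real, Real.norm_eq_abs] at hμ
    rcases (abs_eq hρ0.le).1 hμ with h | h
    · have h' : μ = ((r₂ : ℚ) : ℂ) := by
        rw [hre, show μ.re = r₂ by linarith]
        simp
      exact hn (h' ▸ hrat r₂)
    · have h' : μ = ((r₁ : ℚ) : ℂ) := by
        rw [hre, show μ.re = r₁ by linarith]
        simp
      exact hn (h' ▸ hrat r₁)
  have hdisc : ∀ᶠ k in atTop, ∀ μ ∈ Metric.closedBall (c : ℂ) ρ,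
      IsUnit (y' + x k - algebraMap ℂ A μ) := by
    have h1 : ∀ᶠ b in 𝓝 (T (y' + z)), ∀ μ ∈ Metric.closedBall (c : ℂ) ρ,
        IsUnit (b - algebraMap ℂ B μ) := by
      refine (isCompact_closedBall (c : ℂ) ρ).eventually_forall_of_forall_eventually fun μ hμ => ?_
      have h2 : ContinuousAt (fun p : B × ℂ => p.1 - algebraMap ℂ B p.2) (T (y' + z), μ) :=
        (continuous_fst.sub ((continuous_algebraMap ℂ B).comp continuous_snd)).continuousAt
      refine h2.preimage_mem_nhds (Units.isOpen.mem_nhds ?_)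
      refine (isUnit_map_sub_algebraMap_iff hspec).2 (hball' _ _ (hdist.trans_le ?_) ?_)
      · linarith
      · have h3 : ‖(c : ℂ) - t‖ < ε / 2 := by
          rw [← Complex.ofReal_sub, Complex.norm_real, Real.norm_eq_abs, abs_lt]
          constructor <;> linarith
        rw [mem_closedBall_iff_norm] at hμ
        calc ‖μ - t‖ = ‖(μ - c) + (c - t)‖ := by ring_nf
          _ ≤ ‖μ - c‖ + ‖(c : ℂ) - t‖ := norm_add_le _ _
          _ < ε := by linarith
    have h4 : Tendsto (fun k => T (y' + x k)) atTop (𝓝 (T (y' + z))) := by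
      simp only [map_add]
      exact tendsto_const_nhds.add hTx
    filter_upwards [h4.eventually h1] with k hk μ hμ
    exact (isUnit_map_sub_algebraMap_iff hspec).1 (hk μ hμ)
  have hunits := isUnit_sub_algebraMap_of_perturbation hx hρ0 hsphere hdisc
  have hsa : IsSelfAdjoint (y' - algebraMap ℂ A t) :=
    hy'.sub (IsSelfAdjoint.algebraMap A (by simp [IsSelfAdjoint]))
  have hy_unit : IsUnit (y' - algebraMap ℂ A t + (y - y')) := by
    refine hsa.isUnit_add (d := d) (fun w hw => ?_) hdist
    by_contra! hlt
    have hwre : w = (w.re : ℂ) := hsa.mem_spectrum_eq_re hw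
    generalize w.re = s at hwre
    subst hwre
    rw [Complex.norm_real, Real.norm_eq_abs, abs_lt] at hlt
    have h5 := hunits _ (hreal (t + s) (abs_le.2 ⟨by linarith, by linarith⟩))
    rw [spectrum.mem_iff, IsUnit.sub_iff] at hw
    refine hw ?_
    convert h5 using 1
    rw [Complex.ofReal_add, map_add]
    abel
  rw [spectrum.mem_iff, IsUnit.sub_iff] at hl
  refine hl ?_
  convert hy_unit using 1
  abel

lemma map_real_smul_of_spectrum_eq [CompleteSpace B]
    (hrr0 : ∀ a : A, IsSelfAdjoint a → a ∈ closure {x : A | IsSelfAdjoint x ∧ IsUnit x})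
    (hsurj : Function.Surjective T) (hspec : ∀ x, spectrum ℂ (T x) = spectrum ℂ x)
    (r : ℝ) (x : A) : T (r • x) = r • T x := by
  obtain ⟨v, hv, hq⟩ := mem_closure_iff_seq_limit.1 (Rat.denseRange_cast (𝕜 := ℝ) r)
  choose q hqv using hv
  obtain rfl : (fun k => (q k : ℝ)) = v := funext hqv
  obtain ⟨z, hz⟩ := hsurj (r • T x - T (r • x))
  have hz0 : z = 0 := by
    refine eq_zero_of_tendsto_map hrr0 hspec (x := fun k => ((q k : ℝ)) • x - r • x) ?_ ?_
    · rw [← sub_self (r • x)]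
      exact (hq.smul_const x).sub_const _
    · have h : ∀ k, T (((q k : ℝ)) • x - r • x) = ((q k : ℝ)) • T x - T (r • x) := by
        intro k
        rw [map_sub, map_ratCast_smul T ℝ ℝ]
      simp only [h, hz]
      exact (hq.smul_const (T x)).sub_const _
  rw [hz0, map_zero, eq_comm, sub_eq_zero] at hz
  exact hz.symm

/-- A surjective additive spectrum preserving map on a C*-algebra of real rank zero is a real
linear homeomorphism. -/
lemma exists_continuousLinearEquiv_of_spectrum_eq [CompleteSpace B]
    (hrr0 : ∀ a : A, IsSelfAdjoint a → a ∈ closure {x : A | IsSelfAdjoint x ∧ IsUnit x})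
    (hsurj : Function.Surjective T) (hspec : ∀ x, spectrum ℂ (T x) = spectrum ℂ x) :
    ∃ L : A ≃L[ℝ] B, ∀ x, L x = T x := by
  let f : A →ₗ[ℝ] B :=
    { T with map_smul' := map_real_smul_of_spectrum_eq hrr0 hsurj hspec }
  have hf : Continuous f := f.continuous_of_seq_closed_graph fun u x y hu hy => by
    obtain ⟨z, hz⟩ := hsurj (y - T x)
    have hz0 : z = 0 := by
      refine eq_zero_of_tendsto_map hrr0 hspec (x := fun k => u k - x) ?_ ?_
      · rw [← sub_self x]
        exact hu.sub_const _
      · simp only [map_sub, hz]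
        exact hy.sub_const (T x)
    rw [hz0, map_zero, eq_comm, sub_eq_zero] at hz
    exact hz
  exact ⟨(LinearEquiv.ofBijective f
    ⟨injective_of_spectrum_eq hspec, hsurj⟩).toContinuousLinearEquivOfContinuous hf, fun _ => rfl⟩

end Preserver

section Idempotent

lemma IsIdempotentElem.sub_algebraMap_mul {R : Type*} [Ring R] [Algebra ℂ R] {p : R}
    (hp : IsIdempotentElem p) {l : ℂ} (h0 : l ≠ 0) (h1 : l - 1 ≠ 0) :
    (algebraMap ℂ R l - p) * (l⁻¹ • (1 - p) + (l - 1)⁻¹ • p) = 1 ∧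
      (l⁻¹ • (1 - p) + (l - 1)⁻¹ • p) * (algebraMap ℂ R l - p) = 1 := by
  have hpp : p * p = p := hp
  have hp1 : p * (1 - p) = 0 := by rw [mul_sub, hpp, mul_one, sub_self]
  have hp2 : (1 - p) * p = 0 := by rw [sub_mul, hpp, one_mul, sub_self]
  have e : algebraMap ℂ R l - p = l • (1 - p) + (l - 1) • p := by
    rw [Algebra.algebraMap_eq_smul_one]
    module
  have hq : (1 - p) * (1 - p) = 1 - p := hp.one_sub
  rw [e]
  constructor <;>
  simp only [mul_add, add_mul, smul_mul_smul_comm, hp1, hp2, hq, hpp, smul_zero, add_zero,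
    zero_add, mul_inv_cancel₀ h0, mul_inv_cancel₀ h1, inv_mul_cancel₀ h0, inv_mul_cancel₀ h1,
    one_smul] <;> abel

lemma IsIdempotentElem.isUnit_sub_algebraMap {R : Type*} [Ring R] [Algebra ℂ R] {p : R}
    (hp : IsIdempotentElem p) {l : ℂ} (h0 : l ≠ 0) (h1 : l - 1 ≠ 0) :
    IsUnit (p - algebraMap ℂ R l) := by
  rw [IsUnit.sub_iff]
  exact isUnit_iff_exists.2 ⟨_, hp.sub_algebraMap_mul h0 h1⟩

lemma isQuasinilpotent_sub_mul_self {R : Type*} [Ring R] [Algebra ℂ R] {q : R}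
    (h : ∀ l : ℂ, l ≠ 0 → l - 1 ≠ 0 → IsUnit (q - algebraMap ℂ R l)) :
    IsQuasinilpotent (q - q * q) := by
  intro s
  rcases eq_or_ne s 0 with rfl | hs
  · simp
  obtain ⟨d, hd⟩ := IsAlgClosed.exists_eq_mul_self (1 - 4 / s)
  have hab : (1 + d) / 2 * ((1 - d) / 2) = s⁻¹ := by
    field_simp at hd ⊢
    linear_combination hd
  have hne : (1 + d) / 2 * ((1 - d) / 2) ≠ 0 := by
    rw [hab]
    exact inv_ne_zero hs
  have hsum : (1 + d) / 2 + (1 - d) / 2 = 1 := by ring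
  generalize (1 + d) / 2 = α at hab hne hsum
  generalize (1 - d) / 2 = β at hab hne hsum
  have hα : α ≠ 0 := left_ne_zero_of_mul hne
  have hβ : β ≠ 0 := right_ne_zero_of_mul hne
  have h1 := h α hα (by rwa [← hsum, sub_add_cancel_left, neg_ne_zero])
  have h2 := h β hβ (by rwa [← hsum, sub_add_cancel_right, neg_ne_zero])
  have h3 : 1 - s • (q - q * q) =
      algebraMap ℂ R s * ((q - algebraMap ℂ R α) * (q - algebraMap ℂ R β)) := by
    have h4 : (q - algebraMap ℂ R α) * (q - algebraMap ℂ R β) =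
        q * q - (α + β) • q + (α * β) • 1 := by
      simp only [Algebra.algebraMap_eq_smul_one, mul_sub, sub_mul, smul_mul_assoc, mul_smul_comm,
        one_mul, mul_one]
      module
    rw [h4, hab, hsum, ← Algebra.smul_def, smul_add, smul_smul, mul_inv_cancel₀ hs]
    module
  rw [h3]
  exact ((isUnit_iff_ne_zero.2 hs).map (algebraMap ℂ R)).mul (h1.mul h2)

/-- Orthogonality of idempotents whose sum is idempotent. -/
lemma mul_eq_zero_of_isIdempotentElem_add {R : Type*} [Ring R] [Algebra ℝ R] {e f : R}
    (he : IsIdempotentElem e) (hf : IsIdempotentElem f) (hef : IsIdempotentElem (e + f)) :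
    e * f = 0 := by
  have h1 : e * f + f * e = 0 := (he.add_iff hf).1 hef
  have hee : e * e = e := he
  have h2 : e * f + e * f * e = 0 := by
    calc e * f + e * f * e = (e * e) * f + e * f * e := by rw [hee]
      _ = e * (e * f + f * e) := by noncomm_ring
      _ = 0 := by rw [h1, mul_zero]
  have h3 : e * f * e + f * e = 0 := by
    calc e * f * e + f * e = e * f * e + f * (e * e) := by rw [hee]
      _ = (e * f + f * e) * e := by noncomm_ring
      _ = 0 := by rw [h1, zero_mul]
  have h4 : e * f = f * e := by
    rw [eq_neg_of_add_eq_zero_left h2, eq_neg_of_add_eq_zero_right h3]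
  have h5 : (2 : ℝ) • (e * f) = 0 := by
    rw [two_smul]
    nth_rewrite 2 [h4]
    exact h1
  exact (smul_eq_zero_iff_right two_ne_zero).1 h5

lemma sum_smul_mul_self {R ι : Type*} [Ring R] [Algebra ℝ R] {e : ι → R}
    (he : ∀ i, IsIdempotentElem (e i)) (hij : ∀ i j, i ≠ j → e i * e j = 0)
    (F : Finset ι) (c : ι → ℝ) :
    (∑ i ∈ F, c i • e i) * (∑ i ∈ F, c i • e i) = ∑ i ∈ F, (c i * c i) • e i := by
  rw [Finset.sum_mul_sum]
  refine Finset.sum_congr rfl fun i hi => ?_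
  rw [Finset.sum_eq_single i]
  · rw [smul_mul_smul_comm, he i]
  · intro j _ hj
    rw [smul_mul_smul_comm, hij i j hj.symm, smul_zero]
  · exact fun h => absurd hi h

variable {A : Type*} [CStarAlgebra A] {B : Type*} [NormedRing B] [NormedAlgebra ℂ B]
  [CompleteSpace B] {T : A →+ B}

lemma eventually_isUnit_one_sub_smul_mul
    (hspec : ∀ x, spectrum ℂ (T x) = spectrum ℂ x) (L : A ≃L[ℝ] B) (hL : ∀ x, L x = T x)
    {p : A} (hp : IsIdempotentElem p) :
    ∀ᶠ v in 𝓝 (1 : B), ∀ s : ℂ, 2 ≤ ‖s‖ → IsUnit (1 - s • (v * T p)) := by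
  set K := ‖1 - p‖ + ‖p‖
  set M := ‖(L.symm : B →L[ℝ] A)‖
  have hcont : ContinuousAt (fun v : B => K * (M * ‖Ring.inverse v - 1‖)) 1 := by
    have h1 : ContinuousAt (Ring.inverse : B → B) 1 := NormedRing.inverse_continuousAt 1
    exact continuousAt_const.mul (continuousAt_const.mul (h1.sub continuousAt_const).norm)
  have hlt : ∀ᶠ v in 𝓝 (1 : B), K * (M * ‖Ring.inverse v - 1‖) < 1 :=
    hcont.eventually (gt_mem_nhds (by simp))
  have hunit : ∀ᶠ v in 𝓝 (1 : B), IsUnit v := Units.isOpen.mem_nhds isUnit_one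
  filter_upwards [hlt, hunit] with v hv hvu s hs
  obtain ⟨u, rfl⟩ := hvu
  rw [Ring.inverse_unit] at hv
  have hs0 : s ≠ 0 := by
    rintro rfl
    norm_num at hs
  have hs1 : 1 ≤ ‖s⁻¹ - 1‖ * ‖s‖ := by
    rw [← norm_mul, sub_mul, inv_mul_cancel₀ hs0, one_mul, norm_sub_rev]
    have := norm_sub_norm_le s 1
    rw [norm_one] at this
    linarith
  have hs2 : s⁻¹ - 1 ≠ 0 := by
    intro h
    rw [h, norm_zero, zero_mul] at hs1
    linarith
  have hinv : ‖(s⁻¹ - 1)⁻¹‖ ≤ ‖s‖ := by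
    rw [norm_inv]
    exact (inv_le_iff_one_le_mul₀' (norm_pos_iff.2 hs2)).2 hs1
  set r : A := s⁻¹⁻¹ • (1 - p) + (s⁻¹ - 1)⁻¹ • p with hr
  have hrmul := hp.sub_algebraMap_mul (inv_ne_zero hs0) hs2
  rw [← hr] at hrmul
  have hrn : ‖r‖ ≤ K * ‖s‖ := by
    calc ‖r‖ ≤ ‖s⁻¹⁻¹ • (1 - p)‖ + ‖(s⁻¹ - 1)⁻¹ • p‖ := norm_add_le _ _
      _ = ‖s‖ * ‖1 - p‖ + ‖(s⁻¹ - 1)⁻¹‖ * ‖p‖ := by rw [norm_smul, norm_smul, inv_inv]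
      _ ≤ ‖s‖ * ‖1 - p‖ + ‖s‖ * ‖p‖ := by gcongr
      _ = K * ‖s‖ := by ring
  set w : B := s⁻¹ • ((↑u⁻¹ : B) - 1) with hw
  have hx : ‖L.symm w‖ ≤ M * (‖s‖⁻¹ * ‖(↑u⁻¹ : B) - 1‖) := by
    refine ((L.symm : B →L[ℝ] A).le_opNorm w).trans_eq ?_
    rw [hw, norm_smul, norm_inv]
  have hTx : T (L.symm w) = w := by rw [← hL, L.apply_symm_apply]
  have hrx : ‖r * L.symm w‖ < 1 := by
    have : 0 < ‖s‖ := norm_pos_iff.2 hs0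
    calc ‖r * L.symm w‖ ≤ ‖r‖ * ‖L.symm w‖ := norm_mul_le _ _
      _ ≤ K * ‖s‖ * (M * (‖s‖⁻¹ * ‖(↑u⁻¹ : B) - 1‖)) := by gcongr
      _ = K * (M * ‖(↑u⁻¹ : B) - 1‖) := by field_simp
      _ < 1 := hv
  have hA : IsUnit (L.symm w - p - algebraMap ℂ A (-s⁻¹)) := by
    have h1 : L.symm w - p - algebraMap ℂ A (-s⁻¹) =
        (algebraMap ℂ A s⁻¹ - p) * (1 - (-(r * L.symm w))) := by
      rw [sub_neg_eq_add, mul_add, ← mul_assoc, hrmul.1, map_neg]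
      noncomm_ring
    rw [h1]
    exact (isUnit_iff_exists.2 ⟨r, hrmul⟩).mul
      (isUnit_one_sub_of_norm_lt_one (by rwa [norm_neg]))
  rw [← isUnit_map_sub_algebraMap_iff hspec, map_sub, hTx] at hA
  have h2 : 1 - s • ((u : B) * T p) =
      algebraMap ℂ B s * (u * (w - T p - algebraMap ℂ B (-s⁻¹))) := by
    rw [← Algebra.smul_def, hw, map_neg, Algebra.algebraMap_eq_smul_one, sub_neg_eq_add, mul_add,
      mul_sub, mul_smul_comm, mul_smul_comm, mul_sub, mul_one, Units.mul_inv, smul_add, smul_sub,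
      smul_smul, smul_smul, mul_inv_cancel₀ hs0]
    module
  rw [h2]
  exact ((isUnit_iff_ne_zero.2 hs0).map (algebraMap ℂ B)).mul (u.isUnit.mul hA)

lemma isIdempotentElem_map_of_spectrum_eq (hsurj : Function.Surjective T)
    (hspec : ∀ x, spectrum ℂ (T x) = spectrum ℂ x) (L : A ≃L[ℝ] B) (hL : ∀ x, L x = T x)
    {p : A} (hp : IsIdempotentElem p) : IsIdempotentElem (T p) := by
  have hone : T 1 = 1 := by simpa using map_algebraMap_of_spectrum_eq hsurj hspec 1
  refine mul_self_eq_of_perturbation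
    (fun n => eq_zero_of_forall_isUnit_one_sub_mul hsurj hspec)
    (isQuasinilpotent_sub_mul_self fun l h0 h1 =>
      (isUnit_map_sub_algebraMap_iff hspec).2 (hp.isUnit_sub_algebraMap h0 h1))
    (eventually_isUnit_one_sub_smul_mul hspec L hL hp) ?_
  have := eventually_isUnit_one_sub_smul_mul hspec L hL hp.one_sub
  rwa [map_sub, hone] at this

lemma map_sum_smul_mul_self_of_spectrum_eq (hsurj : Function.Surjective T)
    (hspec : ∀ x, spectrum ℂ (T x) = spectrum ℂ x) (L : A ≃L[ℝ] B) (hL : ∀ x, L x = T x)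
    {ι : Type*} {e : ι → A} (he : ∀ i, IsIdempotentElem (e i))
    (hij : ∀ i j, i ≠ j → e i * e j = 0) (F : Finset ι) (c : ι → ℝ) :
    L ((∑ i ∈ F, c i • e i) * (∑ i ∈ F, c i • e i)) =
      L (∑ i ∈ F, c i • e i) * L (∑ i ∈ F, c i • e i) := by
  have hid : ∀ {p : A}, IsIdempotentElem p → IsIdempotentElem (L p) := fun hp => by
    rw [hL]
    exact isIdempotentElem_map_of_spectrum_eq hsurj hspec L hL hp
  simp only [sum_smul_mul_self he hij, map_sum, map_smul]
  rw [sum_smul_mul_self (fun i => hid (he i))]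
  intro i j h
  refine mul_eq_zero_of_isIdempotentElem_add (hid (he i)) (hid (he j)) ?_
  rw [← map_add]
  refine hid (((he i).add_iff (he j)).2 ?_)
  rw [hij i j h, hij j i h.symm, add_zero]

end Idempotent

section RealRankZero

variable {A : Type*} [CStarAlgebra A]

/-- In a C*-algebra of real rank zero the self-adjoint elements are approximated by real linear
combinations of orthogonal projections. -/
lemma exists_orthogonal_idempotents_norm_sub_lt
    (hrr0 : ∀ a : A, IsSelfAdjoint a → a ∈ closure {x : A | IsSelfAdjoint x ∧ IsUnit x})
    {a : A} (ha : IsSelfAdjoint a) {ε : ℝ} (hε : 0 < ε) :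
    ∃ (F : Finset ℤ) (e : ℤ → A) (c : ℤ → ℝ), (∀ i, IsIdempotentElem (e i)) ∧
      (∀ i j, i ≠ j → e i * e j = 0) ∧ ‖a - ∑ i ∈ F, c i • e i‖ < ε := by
  obtain ⟨b, hb, hab, hrat⟩ := exists_isSelfAdjoint_forall_isUnit_sub_rat hrr0 ha (half_pos hε)
  obtain ⟨n, hn⟩ := exists_nat_gt (2 / ε)
  have hn0 : (0 : ℝ) < n := lt_trans (by positivity) hn
  have hcont : ∀ h : ℤ → ℝ, ContinuousOn (fun t : ℝ => h ⌊n * t⌋) (spectrum ℝ b) := by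
    intro h t ht
    have hne : (⌊n * t⌋ : ℝ) ≠ n * t := by
      intro heq
      have h1 : (((⌊n * t⌋ : ℚ) / n : ℚ) : ℂ) = (t : ℂ) := by
        have : t = (⌊n * t⌋ : ℝ) / n := by rw [heq]; field_simp
        rw [this]
        push_cast
        rw [heq]
        field_simp
      have h2 := hrat ((⌊n * t⌋ : ℚ) / n)
      rw [h1, IsUnit.sub_iff] at h2
      exact (spectrum.mem_iff.1 ht) h2
    have hev : ∀ᶠ s : ℝ in 𝓝 t, h ⌊n * t⌋ = h ⌊n * s⌋ := by
      have h3 : ContinuousAt (fun s : ℝ => n * s) t := by fun_prop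
      filter_upwards [h3.eventually (Ioo_mem_nhds ((Int.floor_le _).lt_of_ne hne)
        (Int.lt_floor_add_one (n * t)))] with s hs
      rw [Int.floor_eq_iff.2 ⟨hs.1.le, hs.2⟩]
    exact (continuousAt_const.congr hev).continuousWithinAt
  obtain ⟨R, hR⟩ := (spectrum.isBounded (𝕜 := ℝ) b).exists_norm_le
  refine ⟨Finset.Icc ⌊n * -R⌋ ⌊n * R⌋, fun i => cfc (fun t : ℝ => if ⌊n * t⌋ = i then 1 else 0) b,
    fun i => i / n, fun i => ?_, fun i j hij => ?_, ?_⟩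
  · rw [IsIdempotentElem, ← cfc_mul _ _ b (hcont fun k => if k = i then 1 else 0)
      (hcont fun k => if k = i then 1 else 0)]
    congr 1
    ext t
    simp
  · rw [← cfc_mul _ _ b (hcont fun k => if k = i then 1 else 0)
      (hcont fun k => if k = j then 1 else 0), ← cfc_zero ℝ b]
    congr 1
    ext t
    by_cases h : ⌊n * t⌋ = i
    · simp [h, hij]
    · simp [h]
  · have hsum : ∑ i ∈ Finset.Icc ⌊n * -R⌋ ⌊n * R⌋,
        ((i : ℝ) / n) • cfc (fun t : ℝ => if ⌊n * t⌋ = i then (1 : ℝ) else 0) b =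
        cfc (fun t : ℝ => (⌊n * t⌋ : ℝ) / n) b := by
      have h1 : ∀ i : ℤ, ((i : ℝ) / n) • cfc (fun t : ℝ => if ⌊n * t⌋ = i then (1 : ℝ) else 0) b =
          cfc (fun t : ℝ => ((i : ℝ) / n) • if ⌊n * t⌋ = i then (1 : ℝ) else 0) b := fun i =>
        (cfc_smul _ _ b (hcont fun k => if k = i then 1 else 0)).symm
      simp only [h1]
      rw [← cfc_sum (fun (i : ℤ) (t : ℝ) => ((i : ℝ) / n) • if ⌊n * t⌋ = i then (1 : ℝ) else 0) b _
        (fun i _ => hcont fun k => ((i : ℝ) / n) • if k = i then (1 : ℝ) else 0)]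
      refine cfc_congr fun t ht => ?_
      have htR := abs_le.1 (hR t ht)
      have hmem : ⌊n * t⌋ ∈ Finset.Icc ⌊n * -R⌋ ⌊n * R⌋ := by
        rw [Finset.mem_Icc]
        constructor <;> gcongr
        · exact htR.1
        · exact htR.2
      simp only [Finset.sum_apply, smul_eq_mul, mul_ite, mul_one, mul_zero, Finset.sum_ite_eq]
      rw [if_pos hmem]
    have hclose : ‖b - cfc (fun t : ℝ => (⌊n * t⌋ : ℝ) / n) b‖ ≤ 1 / n := by
      nth_rewrite 1 [← cfc_id' ℝ b]
      rw [← cfc_sub (fun t => t) _ b continuousOn_id (hcont fun k => (k : ℝ) / n)]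
      refine norm_cfc_le (by positivity) fun t _ => ?_
      have h1 := Int.floor_le (n * t)
      have h2 := Int.lt_floor_add_one (n * t)
      have h3 : t - (⌊n * t⌋ : ℝ) / n = (n * t - ⌊n * t⌋) / n := by field_simp
      rw [h3, Real.norm_eq_abs, abs_of_nonneg (div_nonneg (by linarith) hn0.le)]
      gcongr
      linarith
    rw [hsum]
    calc ‖a - cfc (fun t : ℝ => (⌊n * t⌋ : ℝ) / n) b‖
        = ‖(a - b) + (b - cfc (fun t : ℝ => (⌊n * t⌋ : ℝ) / n) b)‖ := by rw [sub_add_sub_cancel]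
      _ ≤ ‖a - b‖ + ‖b - cfc (fun t : ℝ => (⌊n * t⌋ : ℝ) / n) b‖ := norm_add_le _ _
      _ < ε / 2 + ε / 2 := by
        refine add_lt_add_of_lt_of_le hab (hclose.trans ?_)
        rw [div_le_iff₀ hn0]
        rw [div_lt_iff₀ hε] at hn
        linarith
      _ = ε := add_halves ε

variable {B : Type*} [NormedRing B] [NormedAlgebra ℂ B]

lemma map_mul_self_of_spectrum_eq [CompleteSpace B] {T : A →+ B}
    (hrr0 : ∀ a : A, IsSelfAdjoint a → a ∈ closure {x : A | IsSelfAdjoint x ∧ IsUnit x})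
    (hsurj : Function.Surjective T) (hspec : ∀ x, spectrum ℂ (T x) = spectrum ℂ x)
    {a : A} (ha : IsSelfAdjoint a) : T (a * a) = T a * T a := by
  obtain ⟨L, hL⟩ := exists_continuousLinearEquiv_of_spectrum_eq hrr0 hsurj hspec
  have hclosed : IsClosed {x : A | L (x * x) = L x * L x} :=
    isClosed_eq (L.continuous.comp (continuous_id.mul continuous_id))
      (L.continuous.mul L.continuous)
  have hmem : a ∈ closure {x : A | L (x * x) = L x * L x} := by
    rw [Metric.mem_closure_iff]
    intro ε hε
    obtain ⟨F, e, c, he, hij, hlt⟩ := exists_orthogonal_idempotents_norm_sub_lt hrr0 ha hε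
    exact ⟨_, map_sum_smul_mul_self_of_spectrum_eq hsurj hspec L hL he hij F c, by
      rwa [dist_eq_norm]⟩
  rw [hclosed.closure_eq] at hmem
  simpa only [Set.mem_ofPred_eq, hL] using hmem

open ComplexStarModule

/-- The complex linear extension of an additive real homogeneous map from the self-adjoint part. -/
noncomputable def AddMonoidHom.selfAdjointExtension (T : A →+ B)
    (hT : ∀ (r : ℝ) (x : A), T (r • x) = r • T x) : A →ₗ[ℂ] B where
  toFun x := T (ℜ x : A) + Complex.I • T (ℑ x : A)
  map_add' x y := by
    simp only [map_add, AddSubgroup.coe_add, smul_add]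
    abel
  map_smul' z x := by
    have hI : ∀ (r : ℝ) (y : B), r • y = (r : ℂ) • y := fun r y => (Complex.coe_smul r y).symm
    simp only [realPart_smul, imaginaryPart_smul, AddSubgroupClass.coe_sub, AddSubgroup.coe_add,
      selfAdjoint.val_smul, map_add, map_sub, hT, hI, RingHom.id_apply, smul_add, smul_smul]
    have hz := Complex.re_add_im z
    generalize (z.re : ℂ) = s at hz
    generalize (z.im : ℂ) = t at hz
    subst hz
    match_scalars
    · ring
    · linear_combination -t * Complex.I_mul_I

end RealRankZero

open ComplexStarModule

/-- If `A` is a unital C*-algebra of real rank zero and `T : A → B` is a surjective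
additive spectrum preserving map into a complex unital Banach algebra, then there is a
unital Jordan homomorphism `S : A → B` agreeing with `T` on the self-adjoint elements. -/
theorem exists_unital_jordan_hom_agreeing_on_selfAdjoints
    {A : Type*} [NormedRing A] [StarRing A] [CStarRing A] [NormedAlgebra ℂ A]
    [CompleteSpace A] [StarModule ℂ A]
    (hrr0 : ∀ a : A, IsSelfAdjoint a → a ∈ closure {x : A | IsSelfAdjoint x ∧ IsUnit x})
    {B : Type*} [NormedRing B] [NormedAlgebra ℂ B] [CompleteSpace B]
    (T : A → B)
    (hsurj : Function.Surjective T)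
    (hadd : ∀ x y : A, T (x + y) = T x + T y)
    (hspec : ∀ x : A, spectrum ℂ (T x) = spectrum ℂ x) :
    ∃ S : A →ₗ[ℂ] B, S 1 = 1 ∧ (∀ x : A, S (x * x) = S x * S x) ∧
      ∀ a : A, IsSelfAdjoint a → S a = T a := by
  let _ : CStarAlgebra A := { }
  let T' : A →+ B := AddMonoidHom.mk' T hadd
  have hsmul := map_real_smul_of_spectrum_eq (T := T') hrr0 hsurj hspec
  have hone : T' 1 = 1 := by simpa using map_algebraMap_of_spectrum_eq (T := T') hsurj hspec 1
  have hmul : ∀ a : A, IsSelfAdjoint a → T' (a * a) = T' a * T' a := fun a =>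
    map_mul_self_of_spectrum_eq hrr0 hsurj hspec
  have hS : ∀ a : A, IsSelfAdjoint a → T'.selfAdjointExtension hsmul a = T' a := by
    intro a ha
    change T' (ℜ a : A) + Complex.I • T' (ℑ a : A) = T' a
    rw [ha.coe_realPart, ha.imaginaryPart]
    simp
  refine ⟨T'.selfAdjointExtension hsmul, ?_, fun x => ?_, hS⟩
  · rw [hS 1 (IsSelfAdjoint.one A), hone]
  · have hu : IsSelfAdjoint (ℜ x : A) := (ℜ x).2
    have hv : IsSelfAdjoint (ℑ x : A) := (ℑ x).2
    have hx := realPart_add_I_smul_imaginaryPart x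
    generalize (ℜ x : A) = u at hu hx
    generalize (ℑ x : A) = v at hv hx
    have huv : IsSelfAdjoint (u * v + v * u) := by
      rw [IsSelfAdjoint, star_add, star_mul, star_mul, hu.star_eq, hv.star_eq, add_comm]
    have huv' : T' (u * v + v * u) = T' u * T' v + T' v * T' u := by
      have h1 := hmul (u + v) (hu.add hv)
      have h2 : (u + v) * (u + v) = u * u + v * v + (u * v + v * u) := by noncomm_ring
      rw [h2, map_add T' _ (u * v + v * u), map_add, map_add T' u v, hmul u hu, hmul v hv] at h1
      rw [← add_right_inj (T' u * T' u + T' v * T' v), h1]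
      noncomm_ring
    have huu : IsSelfAdjoint (u * u) := by rw [IsSelfAdjoint, star_mul, hu.star_eq]
    have hvv : IsSelfAdjoint (v * v) := by rw [IsSelfAdjoint, star_mul, hv.star_eq]
    have hxx : x * x = u * u - v * v + Complex.I • (u * v + v * u) := by
      rw [← hx, add_mul, mul_add, mul_add, smul_mul_smul_comm, Complex.I_mul_I, mul_smul_comm,
        smul_mul_assoc, smul_add]
      module
    rw [hxx, ← hx]
    simp only [map_add _ (u * u - v * v), map_add _ u, map_sub, map_smul]
    rw [hS _ huv, hS _ huu, hS _ hvv, hS _ hu, hS _ hv, hmul u hu, hmul v hv, huv', add_mul,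
      mul_add, mul_add, smul_mul_smul_comm, Complex.I_mul_I, mul_smul_comm, smul_mul_assoc,
      smul_add]
    module
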